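/- arXiv:1802.01344 — 7 statements merged into one kernel-verified Lean document; each statement's English description precedes it below -/
import Mathlib

section
/- Any two minimizers of the LASSO problem have the same measurement: if a⁽¹⁾, a⁽²⁾ ∈ α_λ, then H a⁽¹⁾ = H a⁽²⁾. -/
/-- Midpoint form of the parallelogram identity for residual sums of squares. -/
lemma sum_sq_sub_midpoint {ι : Type*} [Fintype ι] (z u v : ι → ℝ) :
    ∑ i, (z i - (u i + v i) / 2) ^ 2 =
      (∑ i, (z i - u i) ^ 2 + ∑ i, (z i - v i) ^ 2) / 2 - (∑ i, (u i - v i) ^ 2) / 4 := by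
  rw [← Finset.sum_add_distrib, Finset.sum_div, Finset.sum_div, ← Finset.sum_sub_distrib]
  exact Finset.sum_congr rfl fun i _ => by ring

/-- Midpoint convexity of the `ℓ¹` norm. -/
lemma sum_abs_midpoint_le {ι : Type*} [Fintype ι] (a b : ι → ℝ) :
    ∑ i, |(a i + b i) / 2| ≤ (∑ i, |a i| + ∑ i, |b i|) / 2 := by
  rw [← Finset.sum_add_distrib, Finset.sum_div]
  refine Finset.sum_le_sum fun i _ => ?_
  rw [abs_div, abs_two]
  have := abs_add_le (a i) (b i)
  gcongr

/-- Any two minimizers of the LASSO problem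
`F(a) = ‖z − H a‖₂² + λ ‖a‖₁` have the same measurement `H a`. -/
theorem lasso_minimizers_same_measurement
    {M N : ℕ} (hMN : M < N) (H : Matrix (Fin M) (Fin N) ℝ) (z : Fin M → ℝ)
    (lam : ℝ) (hlam : 0 < lam)
    (F : (Fin N → ℝ) → ℝ)
    (hF : ∀ a : Fin N → ℝ,
      F a = (∑ i : Fin M, (z i - H.mulVec a i) ^ 2) + lam * ∑ n : Fin N, |a n|)
    (a₁ a₂ : Fin N → ℝ)
    (hmin₁ : ∀ b : Fin N → ℝ, F a₁ ≤ F b)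
    (hmin₂ : ∀ b : Fin N → ℝ, F a₂ ≤ F b) :
    H.mulVec a₁ = H.mulVec a₂ := by
  have hmul (i : Fin M) : H.mulVec (fun n => (a₁ n + a₂ n) / 2) i =
      (H.mulVec a₁ i + H.mulVec a₂ i) / 2 := by
    simp only [Matrix.mulVec, dotProduct]
    rw [← Finset.sum_add_distrib, Finset.sum_div]
    exact Finset.sum_congr rfl fun n _ => by ring
  have hmid₁ := hmin₁ fun n => (a₁ n + a₂ n) / 2
  have hmid₂ := hmin₂ fun n => (a₁ n + a₂ n) / 2
  simp only [hF, hmul, sum_sq_sub_midpoint] at hmid₁ hmid₂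
  have habs := mul_le_mul_of_nonneg_left (sum_abs_midpoint_le a₁ a₂) hlam.le
  have hnonneg : ∀ i ∈ Finset.univ, 0 ≤ (H.mulVec a₁ i - H.mulVec a₂ i) ^ 2 :=
    fun i _ => sq_nonneg _
  have hzero : ∑ i, (H.mulVec a₁ i - H.mulVec a₂ i) ^ 2 = 0 :=
    le_antisymm (by linarith) (Finset.sum_nonneg hnonneg)
  ext i
  have hi := (Finset.sum_eq_zero_iff_of_nonneg hnonneg).mp hzero i (Finset.mem_univ i)
  exact sub_eq_zero.mp (pow_eq_zero_iff two_ne_zero |>.mp hi)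
end

section
/- Any two minimizers of the LASSO problem have the same sign over their common support: if a⁽¹⁾, a⁽²⁾ ∈ α_λ, then a⁽¹⁾_m · a⁽²⁾_m ≥ 0 (equivalently, sign(a⁽¹⁾_m) sign(a⁽²⁾_m) ≥ 0) for every index m. -/
theorem abs_midpoint_le (x y : ℝ) : |(x + y) / 2| ≤ (|x| + |y|) / 2 := by
  rw [abs_div, abs_two]
  linarith [abs_add_le x y]

theorem abs_midpoint_lt_of_mul_neg {x y : ℝ} (h : x * y < 0) :
    |(x + y) / 2| < (|x| + |y|) / 2 := by
  rw [abs_lt]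
  rcases mul_neg_iff.mp h with ⟨hx, hy⟩ | ⟨hx, hy⟩
  · rw [abs_of_pos hx, abs_of_neg hy]
    constructor <;> linarith
  · rw [abs_of_neg hx, abs_of_pos hy]
    constructor <;> linarith

/-- Any two minimizers of the LASSO problem have the same sign over their common
support: `a₁ m * a₂ m ≥ 0` for every index `m`. -/
theorem lasso_minimizers_same_sign
    {M N : ℕ} (hMN : M < N) (H : Matrix (Fin M) (Fin N) ℝ) (z : Fin M → ℝ)
    (lam : ℝ) (hlam : 0 < lam)
    (F : (Fin N → ℝ) → ℝ)
    (hF : ∀ a : Fin N → ℝ,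
      F a = (∑ i : Fin M, (z i - H.mulVec a i) ^ 2) + lam * ∑ n : Fin N, |a n|)
    (a₁ a₂ : Fin N → ℝ)
    (hmin₁ : ∀ b : Fin N → ℝ, F a₁ ≤ F b)
    (hmin₂ : ∀ b : Fin N → ℝ, F a₂ ≤ F b) :
    ∀ m : Fin N, 0 ≤ a₁ m * a₂ m := by
  intro m
  by_contra! hneg
  let b : Fin N → ℝ := fun n => (a₁ n + a₂ n) / 2
  have hb : b = (1 / 2 : ℝ) • (a₁ + a₂) := by
    ext n
    simp only [b, Pi.smul_apply, Pi.add_apply, smul_eq_mul]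
    ring
  have hH (i : Fin M) : H.mulVec b i = (H.mulVec a₁ i + H.mulVec a₂ i) / 2 := by
    rw [hb, Matrix.mulVec_smul, Matrix.mulVec_add]
    simp only [Pi.smul_apply, Pi.add_apply, smul_eq_mul]
    ring
  have hfit : ∑ i, (z i - H.mulVec b i) ^ 2 ≤
      (∑ i, (z i - H.mulVec a₁ i) ^ 2 + ∑ i, (z i - H.mulVec a₂ i) ^ 2) / 2 := by
    rw [← Finset.sum_add_distrib, Finset.sum_div]
    refine Finset.sum_le_sum fun i _ => ?_
    rw [hH]
    nlinarith [sq_nonneg (H.mulVec a₁ i - H.mulVec a₂ i)]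
  have hnorm : ∑ n, |b n| < (∑ n, |a₁ n| + ∑ n, |a₂ n|) / 2 := by
    rw [← Finset.sum_add_distrib, Finset.sum_div]
    exact Finset.sum_lt_sum (fun n _ => abs_midpoint_le _ _)
      ⟨m, Finset.mem_univ m, abs_midpoint_lt_of_mul_neg hneg⟩
  have h₁ := hmin₁ b
  have h₂ := hmin₂ b
  rw [hF, hF] at h₁ h₂
  linarith [mul_lt_mul_of_pos_left hnorm hlam]
end

section
/- Every extreme point of the LASSO solution set α_λ is sparse: if a is an extreme point of α_λ, then the number of nonzero entries of a is at most M, i.e., ‖a‖₀ ≤ M. -/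
/-- A matrix with `M` rows has a nonzero kernel vector supported in any set of more than `M`
columns. -/
theorem exists_mulVec_eq_zero_of_card_lt {M N : ℕ} (H : Matrix (Fin M) (Fin N) ℝ)
    (S : Finset (Fin N)) (hS : M < S.card) :
    ∃ v : Fin N → ℝ, v ≠ 0 ∧ H.mulVec v = 0 ∧ ∀ n, n ∉ S → v n = 0 := by
  have hdep : ¬ LinearIndependent ℝ (fun n : S => H.col n) := by
    intro h
    have := h.fintype_card_le_finrank
    simp at this
    omega
  obtain ⟨g, hg, ⟨k, hk⟩, hne⟩ := Fintype.not_linearIndependent_iff.1 hdep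
  refine ⟨fun n => if h : n ∈ S then g ⟨n, h⟩ else 0, fun h0 => hne ?_, ?_, fun n hn => dif_neg hn⟩
  · simpa [hk] using congrFun h0 k
  · ext i
    have hi := congrFun hg i
    simp only [Finset.sum_apply, Pi.smul_apply, smul_eq_mul, Pi.zero_apply, Matrix.col_apply] at hi
    refine Eq.trans ?_ hi
    rw [Matrix.mulVec, dotProduct, ← Finset.sum_subset (Finset.subset_univ S),
      ← Finset.sum_coe_sort S]
    · exact Finset.sum_congr rfl fun n _ => by simp [mul_comm]
    · intro n _ hn
      simp [hn]

/-- A vector `v` supported in the support of `a` can be scaled to be dominated by `a`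
entrywise. -/
theorem exists_pos_abs_mul_le {ι : Type*} [Finite ι] (a v : ι → ℝ)
    (h : ∀ n, a n = 0 → v n = 0) : ∃ ε : ℝ, 0 < ε ∧ ∀ n, |ε * v n| ≤ |a n| := by
  have hev : ∀ᶠ ε : ℝ in nhdsWithin 0 (Set.Ioi 0), ∀ n, |ε * v n| ≤ |a n| := by
    refine Filter.eventually_all.2 fun n => ?_
    by_cases hn : a n = 0
    · simp [hn, h n hn]
    · have hc : Filter.Tendsto (fun ε : ℝ => |ε * v n|) (nhds 0) (nhds 0) := by
        have : Continuous fun ε : ℝ => |ε * v n| := by fun_prop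
        simpa using this.tendsto 0
      exact ((hc.mono_left nhdsWithin_le_nhds).eventually_lt_const (abs_pos.2 hn)).mono
        fun _ => le_of_lt
  obtain ⟨ε, hε, hpos⟩ := (hev.and self_mem_nhdsWithin).exists
  exact ⟨ε, hpos, hε⟩

theorem abs_add_add_abs_sub_of_abs_le {x y : ℝ} (h : |y| ≤ |x|) :
    |x + y| + |x - y| = 2 * |x| := by
  grind

/-- Every extreme point of the LASSO solution set `α_λ` has at most `M` nonzero
entries. -/
theorem lasso_extreme_points_sparse
    {M N : ℕ} (hMN : M < N) (H : Matrix (Fin M) (Fin N) ℝ) (z : Fin M → ℝ)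
    (lam : ℝ) (hlam : 0 < lam)
    (F : (Fin N → ℝ) → ℝ)
    (hF : ∀ a : Fin N → ℝ,
      F a = (∑ i : Fin M, (z i - H.mulVec a i) ^ 2) + lam * ∑ n : Fin N, |a n|)
    (α : Set (Fin N → ℝ))
    (hα : α = {a : Fin N → ℝ | ∀ b : Fin N → ℝ, F a ≤ F b}) :
    ∀ a ∈ Set.extremePoints ℝ α,
      (Finset.univ.filter fun n : Fin N => a n ≠ 0).card ≤ M := by
  intro a ha
  by_contra! hcard
  obtain ⟨v, hv, hHv, hsupp⟩ := exists_mulVec_eq_zero_of_card_lt H _ hcard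
  obtain ⟨ε, hε, hle⟩ := exists_pos_abs_mul_le a v fun n hn => hsupp n (by simp [hn])
  have hmin : ∀ b, F a ≤ F b := by
    have := ha.1
    rwa [hα] at this
  have hsum : F (a + ε • v) + F (a - ε • v) = 2 * F a := by
    have habs : ∑ n, |(a + ε • v) n| + ∑ n, |(a - ε • v) n| = 2 * ∑ n, |a n| := by
      rw [← Finset.sum_add_distrib, Finset.mul_sum]
      exact Finset.sum_congr rfl fun n _ => abs_add_add_abs_sub_of_abs_le (hle n)
    have hadd : H.mulVec (a + ε • v) = H.mulVec a := by
      simp [Matrix.mulVec_add, Matrix.mulVec_smul, hHv]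
    have hsub : H.mulVec (a - ε • v) = H.mulVec a := by
      simp [Matrix.mulVec_sub, Matrix.mulVec_smul, hHv]
    rw [hF, hF, hF, hadd, hsub]
    linear_combination lam * habs
  have hp := hmin (a + ε • v)
  have hm := hmin (a - ε • v)
  have hpα : a + ε • v ∈ α := by
    rw [hα]
    exact fun b => by linarith [hmin b]
  have hmα : a - ε • v ∈ α := by
    rw [hα]
    exact fun b => by linarith [hmin b]
  have hseg : a ∈ openSegment ℝ (a + ε • v) (a - ε • v) :=
    ⟨1 / 2, 1 / 2, by norm_num, by norm_num, by norm_num, by module⟩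
  have heq : a + ε • v = a := ha.2 hpα hmα hseg
  exact smul_ne_zero hε.ne' hv (by simpa using heq)
end

section
/- The LASSO solution set coincides with the solution set of the constrained minimum-ℓ₁ problem at the common measurement: if z₀ = H a* for some (equivalently, every) a* ∈ α_λ, then α_λ = argmin { ‖a‖₁ : a ∈ ℝ^N, H a = z₀ }. -/
/-- The LASSO solution set coincides with the solution set of the constrained
minimum-ℓ₁ problem at the common measurement `z₀ = H a*`. -/
theorem lasso_solution_set_eq_min_l1_solution_set
    {M N : ℕ} (hMN : M < N) (H : Matrix (Fin M) (Fin N) ℝ) (z : Fin M → ℝ)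
    (lam : ℝ) (hlam : 0 < lam)
    (F : (Fin N → ℝ) → ℝ)
    (hF : ∀ a : Fin N → ℝ,
      F a = (∑ i : Fin M, (z i - H.mulVec a i) ^ 2) + lam * ∑ n : Fin N, |a n|)
    (α : Set (Fin N → ℝ))
    (hα : α = {a : Fin N → ℝ | ∀ b : Fin N → ℝ, F a ≤ F b})
    (astar : Fin N → ℝ) (hastar : astar ∈ α)
    (z₀ : Fin M → ℝ) (hz₀ : z₀ = H.mulVec astar)
    (hsame : ∀ a ∈ α, H.mulVec a = z₀) :
    α = {a : Fin N → ℝ | H.mulVec a = z₀ ∧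
      ∀ b : Fin N → ℝ, H.mulVec b = z₀ → (∑ n : Fin N, |a n|) ≤ ∑ n : Fin N, |b n|} := by
  ext a
  constructor
  · intro ha
    have hHa := hsame a ha
    rw [hα] at ha
    refine ⟨hHa, fun b hb => ?_⟩
    have hab := ha b
    rw [hF a, hF b, hHa, hb] at hab
    exact le_of_mul_le_mul_left (le_of_add_le_add_left hab) hlam
  · rintro ⟨hHa, hmin⟩
    rw [hα] at hastar ⊢
    intro b
    refine le_trans ?_ (hastar b)
    rw [hF a, hF astar, hHa, ← hz₀]
    gcongr _ + lam * ?_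
    exact hmin astar hz₀.symm
end

section
/- There exists a sign vector s ∈ ℝ^N with s_m ∈ {−1, 0, 1} for every m such that |a_m| = s_m · a_m for all a ∈ α_λ and all indices m; consequently, the componentwise absolute-value map T(a) = (|a₁|, …, |a_N|) agrees on α_λ with multiplication by the diagonal matrix R with diagonal entries s_m, and is therefore affine (indeed linear) on α_λ. -/
/-- A sum of squared residuals plus a positive multiple of the `ℓ¹` norm has no two minimizers
whose coordinates at some index have strictly opposite signs. -/
lemma lasso_minimizers_mul_nonneg {ι κ : Type*} [Fintype ι] [Fintype κ]
    (H : Matrix ι κ ℝ) (z : ι → ℝ) {lam : ℝ} (hlam : 0 < lam) {F : (κ → ℝ) → ℝ}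
    (hF : ∀ a, F a = (∑ i, (z i - H.mulVec a i) ^ 2) + lam * ∑ n, |a n|)
    {a b : κ → ℝ} (ha : ∀ c, F a ≤ F c) (hb : ∀ c, F b ≤ F c) (m : κ) :
    0 ≤ a m * b m := by
  by_contra! hneg
  set c : κ → ℝ := (1 / 2 : ℝ) • (a + b) with hc
  have hsq : ∑ i, (z i - H.mulVec c i) ^ 2 ≤
      (∑ i, (z i - H.mulVec a i) ^ 2 + ∑ i, (z i - H.mulVec b i) ^ 2) / 2 := by
    rw [← Finset.sum_add_distrib, Finset.sum_div]
    refine Finset.sum_le_sum fun i _ => ?_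
    have hi : H.mulVec c i = (H.mulVec a i + H.mulVec b i) / 2 := by
      simp only [hc, Matrix.mulVec_smul, Matrix.mulVec_add, Pi.smul_apply, Pi.add_apply,
        smul_eq_mul]
      ring
    rw [hi]
    nlinarith [sq_nonneg (H.mulVec a i - H.mulVec b i)]
  have hcn (n : κ) : |c n| = |a n + b n| / 2 := by
    simp only [hc, Pi.smul_apply, Pi.add_apply, smul_eq_mul, abs_mul]
    norm_num
    ring
  have habs : ∑ n, |c n| < (∑ n, |a n| + ∑ n, |b n|) / 2 := by
    rw [← Finset.sum_add_distrib, Finset.sum_div]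
    refine Finset.sum_lt_sum (fun n _ => ?_) ⟨m, Finset.mem_univ m, ?_⟩
    · rw [hcn]
      linarith [abs_add_le (a n) (b n)]
    · have hlt : |a m + b m| < |a m| + |b m| := by
        refine lt_of_le_of_ne (abs_add_le _ _) fun h => ?_
        rcases (abs_add_eq_add_abs_iff _ _).1 h with h | h <;> nlinarith
      rw [hcn]
      linarith
  have hac := ha c
  have hbc := hb c
  rw [hF, hF c] at hac hbc
  nlinarith [mul_lt_mul_of_pos_left habs hlam]


/-- There exists a sign vector `s` with entries in `{-1, 0, 1}` such that
`|a m| = s m * a m` for all `a` in the LASSO solution set `α_λ` and all indices `m`;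
consequently, the componentwise absolute-value map agrees on `α_λ` with multiplication
by the diagonal matrix with diagonal `s`. -/
theorem lasso_abs_map_is_linear_on_solution_set
    {M N : ℕ} (hMN : M < N) (H : Matrix (Fin M) (Fin N) ℝ) (z : Fin M → ℝ)
    (lam : ℝ) (hlam : 0 < lam)
    (F : (Fin N → ℝ) → ℝ)
    (hF : ∀ a : Fin N → ℝ,
      F a = (∑ i : Fin M, (z i - H.mulVec a i) ^ 2) + lam * ∑ n : Fin N, |a n|)
    (α : Set (Fin N → ℝ))
    (hα : α = {a : Fin N → ℝ | ∀ b : Fin N → ℝ, F a ≤ F b})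
    (hne : α.Nonempty) :
    ∃ s : Fin N → ℝ,
      (∀ m : Fin N, s m = -1 ∨ s m = 0 ∨ s m = 1) ∧
      (∀ a ∈ α, ∀ m : Fin N, |a m| = s m * a m) ∧
      (∀ a ∈ α, (fun m : Fin N => |a m|) = (Matrix.diagonal s).mulVec a) := by
  classical
  have habs : ∀ a ∈ α, ∀ m, |a m| = (if ∃ b ∈ α, 0 < b m then 1 else -1) * a m := by
    intro a ha m
    split_ifs with h
    · obtain ⟨b, hb, hbm⟩ := h
      rw [hα] at ha hb
      rw [one_mul, abs_of_nonneg]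
      exact nonneg_of_mul_nonneg_left (lasso_minimizers_mul_nonneg H z hlam hF ha hb m) hbm
    · push Not at h
      rw [abs_of_nonpos (h a ha), neg_one_mul]
  refine ⟨fun m => if ∃ b ∈ α, 0 < b m then 1 else -1, fun m => ?_, habs, fun a ha => ?_⟩
  · dsimp only
    split_ifs <;> simp
  · ext m
    rw [Matrix.mulVec_diagonal]
    exact habs a ha m
end

section
/- Let T : ℝ^N → ℝ^N be the componentwise absolute-value map T(a) = (|a₁|, …, |a_N|). Then the restriction of T to the LASSO solution set α_λ is injective, the image T(α_λ) is convex and compact, and for every extreme point a_E of α_λ, the point T(a_E) is an extreme point of T(α_λ). -/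
/-- Two points minimizing the LASSO objective, whose midpoint is a minimizer as well, have
coordinatewise compatible signs. -/
theorem mul_nonneg_of_lasso_midpoint_le {M N : Type*} [Fintype M] [Fintype N]
    (H : Matrix M N ℝ) (z : M → ℝ) {lam : ℝ} (hlam : 0 < lam) (F : (N → ℝ) → ℝ)
    (hF : ∀ a, F a = (∑ i, (z i - H.mulVec a i) ^ 2) + lam * ∑ n, |a n|)
    {a b : N → ℝ} (ha : F a ≤ F ((1 / 2 : ℝ) • a + (1 / 2 : ℝ) • b))
    (hb : F b ≤ F ((1 / 2 : ℝ) • a + (1 / 2 : ℝ) • b)) (n : N) : 0 ≤ a n * b n := by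
  rw [hF, hF ((1 / 2 : ℝ) • a + (1 / 2 : ℝ) • b)] at ha hb
  set c := (1 / 2 : ℝ) • a + (1 / 2 : ℝ) • b with hc
  have hcn (m : N) : c m = (a m + b m) / 2 := by
    simp only [hc, Pi.add_apply, Pi.smul_apply, smul_eq_mul]; ring
  have hHc (i : M) : H.mulVec c i = (H.mulVec a i + H.mulVec b i) / 2 := by
    simp only [hc, Matrix.mulVec_add, Matrix.mulVec_smul, Pi.add_apply, Pi.smul_apply,
      smul_eq_mul]
    ring
  have hquad : 2 * ∑ i, (z i - H.mulVec c i) ^ 2 ≤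
      ∑ i, (z i - H.mulVec a i) ^ 2 + ∑ i, (z i - H.mulVec b i) ^ 2 := by
    rw [Finset.mul_sum, ← Finset.sum_add_distrib]
    refine Finset.sum_le_sum fun i _ => ?_
    rw [hHc]
    nlinarith [sq_nonneg (H.mulVec a i - H.mulVec b i)]
  have hdefect (m : N) : 0 ≤ |a m| + |b m| - 2 * |c m| := by
    rw [hcn, abs_div, abs_two]
    linarith [abs_add_le (a m) (b m)]
  have hsum : ∑ m, (|a m| + |b m| - 2 * |c m|) ≤ 0 := by
    rw [Finset.sum_sub_distrib, Finset.sum_add_distrib, ← Finset.mul_sum]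
    nlinarith
  have hle := (Finset.single_le_sum (fun m _ => hdefect m) (Finset.mem_univ n)).trans hsum
  rw [hcn, abs_div, abs_two] at hle
  have heq : |a n| + |b n| ≤ |a n + b n| := by linarith
  have hsq := mul_self_le_mul_self (by positivity) heq
  nlinarith [abs_mul_abs_self (a n), abs_mul_abs_self (b n), abs_mul_abs_self (a n + b n),
    mul_nonneg (abs_nonneg (a n)) (abs_nonneg (b n))]

/-- The absolute value is injective on numbers of compatible sign. -/
theorem eq_of_abs_eq_abs_of_mul_nonneg {x y : ℝ} (hxy : 0 ≤ x * y) (h : |x| = |y|) : x = y := by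
  rcases abs_eq_abs.1 h with h | h
  · exact h
  · subst h
    have : y = 0 := by nlinarith [mul_self_nonneg y]
    simp [this]

/-- The absolute value is affine on the segment between numbers of compatible sign. -/
theorem abs_mul_add_mul_of_mul_nonneg {x y s t : ℝ} (hxy : 0 ≤ x * y) (hs : 0 ≤ s) (ht : 0 ≤ t) :
    |s * x + t * y| = s * |x| + t * |y| := by
  have h : 0 ≤ s * x * (t * y) := by
    have := mul_nonneg (mul_nonneg hs ht) hxy
    linarith
  rw [(abs_add_eq_add_abs_iff _ _).2 (mul_nonneg_iff.1 h), abs_mul, abs_mul, abs_of_nonneg hs,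
    abs_of_nonneg ht]


/-- The componentwise absolute-value map `T` restricted to the LASSO solution set
`α_λ` is injective, its image `T(α_λ)` is convex and compact, and `T` maps extreme
points of `α_λ` to extreme points of `T(α_λ)`. -/
theorem lasso_abs_map_injective_image_convex_compact_extreme
    {M N : ℕ} (hMN : M < N) (H : Matrix (Fin M) (Fin N) ℝ) (z : Fin M → ℝ)
    (lam : ℝ) (hlam : 0 < lam)
    (F : (Fin N → ℝ) → ℝ)
    (hF : ∀ a : Fin N → ℝ,
      F a = (∑ i : Fin M, (z i - H.mulVec a i) ^ 2) + lam * ∑ n : Fin N, |a n|)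
    (α : Set (Fin N → ℝ))
    (hα : α = {a : Fin N → ℝ | ∀ b : Fin N → ℝ, F a ≤ F b})
    (hne : α.Nonempty) (hconv : Convex ℝ α) (hcomp : IsCompact α)
    (T : (Fin N → ℝ) → (Fin N → ℝ))
    (hT : ∀ a : Fin N → ℝ, T a = fun m : Fin N => |a m|) :
    Set.InjOn T α ∧ Convex ℝ (T '' α) ∧ IsCompact (T '' α) ∧
      ∀ a ∈ Set.extremePoints ℝ α, T a ∈ Set.extremePoints ℝ (T '' α) := by
  have hsign {a b : Fin N → ℝ} (ha : a ∈ α) (hb : b ∈ α) (n : Fin N) : 0 ≤ a n * b n := by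
    rw [hα] at ha hb
    exact mul_nonneg_of_lasso_midpoint_le H z hlam F hF (ha _) (hb _) n
  have hinj : Set.InjOn T α := fun a ha b hb hab => funext fun n =>
    eq_of_abs_eq_abs_of_mul_nonneg (hsign ha hb n) (by simpa [hT] using congrFun hab n)
  have haff {a b : Fin N → ℝ} (ha : a ∈ α) (hb : b ∈ α) {s t : ℝ} (hs : 0 ≤ s) (ht : 0 ≤ t) :
      T (s • a + t • b) = s • T a + t • T b := by
    ext n
    simpa [hT] using abs_mul_add_mul_of_mul_nonneg (hsign ha hb n) hs ht
  refine ⟨hinj, ?_, hcomp.image ?_, ?_⟩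
  · rintro _ ⟨a, ha, rfl⟩ _ ⟨b, hb, rfl⟩ s t hs ht hst
    exact ⟨_, hconv ha hb hs ht hst, haff ha hb hs ht⟩
  · rw [funext hT]
    fun_prop
  · rintro a ⟨ha, hext⟩
    refine ⟨Set.mem_image_of_mem T ha, ?_⟩
    rintro _ ⟨b, hb, rfl⟩ _ ⟨c, hc, rfl⟩ ⟨s, t, hs, ht, hst, h⟩
    rw [← haff hb hc hs.le ht.le] at h
    rw [hext hb hc ⟨s, t, hs, ht, hst, hinj (hconv hb hc hs.le ht.le hst) ha h⟩]
end

section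
/- Let X be a real vector space, Y a real inner product space, L : X → Y and H : X → ℝ^M linear maps with ker L ∩ ker H = {0}, E : ℝ^M → ℝ strictly convex, and λ > 0. Then the functional J(f) = E(H f) + λ ‖L f‖² is strictly convex on X: for all f₁ ≠ f₂ in X and all β ∈ (0,1), J(β f₁ + (1−β) f₂) < β J(f₁) + (1−β) J(f₂). -/
theorem norm_sq_smul_add_one_sub_smul {Y : Type*} [NormedAddCommGroup Y]
    [InnerProductSpace ℝ Y] (a b : Y) (β : ℝ) :
    ‖β • a + (1 - β) • b‖ ^ 2 =
      β * ‖a‖ ^ 2 + (1 - β) * ‖b‖ ^ 2 - β * (1 - β) * ‖a - b‖ ^ 2 := by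
  rw [norm_add_sq_real, norm_sub_sq_real, norm_smul, norm_smul, mul_pow, mul_pow,
    Real.norm_eq_abs, Real.norm_eq_abs, sq_abs, sq_abs, real_inner_smul_left,
    real_inner_smul_right]
  ring

/-- The functional `J(f) = E(H f) + λ ‖L f‖²` is strictly convex on `X` whenever
`E` is strictly convex, `λ > 0`, `L`, `H` are linear, and `ker L ∩ ker H = {0}`. -/
theorem tikhonov_objective_strictly_convex
    {M : ℕ} {X Y : Type*} [AddCommGroup X] [Module ℝ X]
    [NormedAddCommGroup Y] [InnerProductSpace ℝ Y]
    (L : X →ₗ[ℝ] Y) (H : X →ₗ[ℝ] (Fin M → ℝ))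
    (hker : ∀ f : X, L f = 0 → H f = 0 → f = 0)
    (E : (Fin M → ℝ) → ℝ) (hE : StrictConvexOn ℝ Set.univ E)
    (lam : ℝ) (hlam : 0 < lam)
    (J : X → ℝ) (hJ : ∀ f : X, J f = E (H f) + lam * ‖L f‖ ^ 2) :
    ∀ f₁ f₂ : X, f₁ ≠ f₂ → ∀ β : ℝ, β ∈ Set.Ioo (0 : ℝ) 1 →
      J (β • f₁ + (1 - β) • f₂) < β * J f₁ + (1 - β) * J f₂ := by
  intro f₁ f₂ hne β ⟨hβ, hβ'⟩
  have hβ₁ : 0 < 1 - β := sub_pos.2 hβ'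
  have hnorm := norm_sq_smul_add_one_sub_smul (L f₁) (L f₂) β
  rw [hJ, hJ, hJ]
  simp only [map_add, map_smul, hnorm]
  by_cases hH : H f₁ = H f₂
  · have hL : L f₁ - L f₂ ≠ 0 := fun h =>
      hne <| sub_eq_zero.1 <| hker _ (by rw [map_sub, h]) (by rw [map_sub, hH, sub_self])
    have hpos : 0 < lam * (β * (1 - β) * ‖L f₁ - L f₂‖ ^ 2) := by positivity
    rw [hH, ← add_smul, add_sub_cancel, one_smul]
    linarith
  · have hlt := hE.2 (Set.mem_univ (H f₁)) (Set.mem_univ (H f₂)) hH hβ hβ₁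
      (add_sub_cancel β 1)
    have hnonneg : 0 ≤ lam * (β * (1 - β) * ‖L f₁ - L f₂‖ ^ 2) := by positivity
    simp only [smul_eq_mul] at hlt
    linarith
end
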